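/- Let F := ℚ(v) be the field of rational functions in one variable v, let V := F[Y, Y^{−1}] be the F-vector space of Laurent polynomials, and define F-linear endomorphisms of V by E(Y^m) := Y^{m+1} and T(Y^m) := v^{−m} Y^m for all m ∈ ℤ (so T is invertible and T E = v^{−1} E T). Let A be the F-subalgebra of End_F(V) generated by E, T, and T^{−1}, and set D₁ := T² + T^{−2} − (v − v^{−1})² E ∈ A (the first hamiltonian of the type A₁ quantum difference Toda lattice). Then for every D ∈ A and every polynomial P ∈ F[X] of degree at least 1, if D commutes with P(D₁), then D lies in the F-subalgebra of A generated by D₁, i.e. D is a polynomial in D₁ with coefficients in F. (This is Lemma C.2 (centralizer sl2) of the paper, the rank-one case underlying the proof that the modified quantum difference Toda systems are maximal commutative subalgebras determined by their first hamiltonians.) -/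

import Mathlib

set_option synthInstance.maxHeartbeats 1000000
set_option maxHeartbeats 1000000

noncomputable section

namespace TodaSL2

/-- The field `F = ℚ(v)` of rational functions in one variable `v`. -/
abbrev Ffld : Type := RatFunc ℚ

/-- The variable `v ∈ ℚ(v)`. -/
def vF : Ffld := RatFunc.X

/-- The `F`-vector space `V = F[Y, Y⁻¹]` of Laurent polynomials, with basis `(Y^m)_{m ∈ ℤ}`,
realized as finitely supported functions `ℤ →₀ F`. -/
abbrev Vsp : Type := ℤ →₀ Ffld

/-- The endomorphism `E` of `V` with `E(Y^m) = Y^{m+1}`. -/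
def Eop : Module.End Ffld Vsp :=
  Finsupp.lsum Ffld fun m : ℤ => Finsupp.lsingle (m + 1)

/-- The endomorphism `T` of `V` with `T(Y^m) = v^{-m} Y^m`. -/
def Tq : Module.End Ffld Vsp :=
  Finsupp.lsum Ffld fun m : ℤ => vF ^ (-m) • Finsupp.lsingle m

/-- The endomorphism `T⁻¹` of `V` with `T⁻¹(Y^m) = v^{m} Y^m`. -/
def TqInv : Module.End Ffld Vsp :=
  Finsupp.lsum Ffld fun m : ℤ => vF ^ m • Finsupp.lsingle m

/-- The `F`-subalgebra `A` of `End_F(V)` generated by `E`, `T` and `T⁻¹`. -/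
def Aalg : Subalgebra Ffld (Module.End Ffld Vsp) :=
  Algebra.adjoin Ffld {Eop, Tq, TqInv}

/-- The first hamiltonian `D₁ = T² + T⁻² - (v - v⁻¹)² E` of the type `A₁` quantum
difference Toda lattice. -/
def D₁ : Module.End Ffld Vsp :=
  Tq ^ 2 + TqInv ^ 2 - (vF - vF⁻¹) ^ 2 • Eop

lemma vF_ne_zero : vF ≠ 0 := RatFunc.X_ne_zero

lemma vF_pow_ne_one {k : ℕ} (hk : 0 < k) : vF ^ k ≠ 1 := by
  intro h
  have h1 : algebraMap (Polynomial ℚ) (RatFunc ℚ) (Polynomial.X ^ k) =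
      algebraMap (Polynomial ℚ) (RatFunc ℚ) 1 := by
    rw [map_pow, RatFunc.algebraMap_X, map_one]
    exact h
  have h2 := congrArg Polynomial.natDegree (RatFunc.algebraMap_injective ℚ h1)
  rw [Polynomial.natDegree_X_pow, Polynomial.natDegree_one] at h2
  omega

lemma vF_zpow_eq_one {k : ℤ} (h : vF ^ k = 1) : k = 0 := by
  obtain ⟨n, rfl | rfl⟩ := k.eq_nat_or_neg
  · by_contra hn
    exact vF_pow_ne_one (k := n) (by omega) (by simpa using h)
  · by_contra hn
    exact vF_pow_ne_one (k := n) (by omega) (by simpa using h)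

lemma vF_zpow_injective : Function.Injective fun m : ℤ => vF ^ m := by
  intro m n h
  have h1 : vF ^ (m - n) = 1 := by
    rw [zpow_sub₀ vF_ne_zero]
    exact (div_eq_one_iff_eq (zpow_ne_zero _ vF_ne_zero)).2 h
  have := vF_zpow_eq_one h1
  omega

/-- The diagonal entries of `D₁`. -/
def diagEntry (m : ℤ) : Ffld := (vF ^ m) ^ 2 + ((vF ^ m)⁻¹) ^ 2

lemma diagEntry_eq {m n : ℤ} (h : diagEntry m = diagEntry n) : m = n ∨ m = -n := by
  have ha : vF ^ m ≠ 0 := zpow_ne_zero _ vF_ne_zero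
  have hb : vF ^ n ≠ 0 := zpow_ne_zero _ vF_ne_zero
  have key : ((vF ^ m) ^ 2 - (vF ^ n) ^ 2) * ((vF ^ m) ^ 2 * (vF ^ n) ^ 2 - 1) = 0 := by
    unfold diagEntry at h
    field_simp at h
    linear_combination h
  rcases mul_eq_zero.1 key with h1 | h1
  · left
    have h2 : vF ^ (m * 2) = vF ^ (n * 2) := by
      rw [zpow_mul, zpow_mul]
      exact_mod_cast sub_eq_zero.1 h1
    have := vF_zpow_injective h2
    omega
  · right
    have h2 : vF ^ (m * 2 + n * 2) = 1 := by
      rw [zpow_add₀ vF_ne_zero, zpow_mul, zpow_mul]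
      exact_mod_cast sub_eq_zero.1 h1
    have := vF_zpow_eq_one h2
    omega

/-- The coefficient of `E` in `-D₁`. -/
def offEntry : Ffld := (vF - vF⁻¹) ^ 2

lemma offEntry_ne_zero : offEntry ≠ 0 := by
  intro h
  have h1 : vF ^ (1 : ℤ) = vF ^ (-1 : ℤ) := by
    simpa using sub_eq_zero.1 (pow_eq_zero_iff (two_ne_zero)|>.1 h)
  have := vF_zpow_injective h1
  omega

lemma Eop_apply (x : Vsp) (j : ℤ) : Eop x j = x (j - 1) := by
  induction x using Finsupp.induction_linear with
  | zero => simp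
  | add f g hf hg => simp [hf, hg]
  | single m a =>
    simp only [Eop, Finsupp.lsum_single, Finsupp.lsingle_apply, Finsupp.single_apply]
    exact if_congr (by omega) rfl rfl

lemma Tq_apply (x : Vsp) (j : ℤ) : Tq x j = vF ^ (-j) * x j := by
  induction x using Finsupp.induction_linear with
  | zero => simp
  | add f g hf hg => simp only [map_add, Finsupp.add_apply, hf, hg, mul_add]
  | single m a =>
    by_cases h : m = j
    · subst h; simp [Tq]
    · simp [Tq, h]

lemma TqInv_apply (x : Vsp) (j : ℤ) : TqInv x j = vF ^ j * x j := by
  induction x using Finsupp.induction_linear with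
  | zero => simp
  | add f g hf hg => simp only [map_add, Finsupp.add_apply, hf, hg, mul_add]
  | single m a =>
    by_cases h : m = j
    · subst h; simp [TqInv]
    · simp [TqInv, h]

lemma D₁_apply (x : Vsp) (j : ℤ) :
    D₁ x j = diagEntry j * x j - offEntry * x (j - 1) := by
  simp only [D₁, pow_two Tq, pow_two TqInv, LinearMap.sub_apply, LinearMap.add_apply,
    LinearMap.smul_apply, Module.End.mul_apply, Finsupp.sub_apply, Finsupp.add_apply,
    Finsupp.smul_apply, Tq_apply, TqInv_apply, Eop_apply, smul_eq_mul, diagEntry, offEntry,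
    zpow_neg]
  ring

lemma D₁_single (m : ℤ) :
    D₁ (Finsupp.single m 1) =
      diagEntry m • Finsupp.single m 1 - offEntry • Finsupp.single (m + 1) 1 := by
  ext j
  rw [D₁_apply]
  simp only [Finsupp.sub_apply, Finsupp.smul_apply, Finsupp.single_apply, smul_eq_mul]
  have h : (m = j - 1) = (m + 1 = j) := propext (by omega)
  simp only [h]
  by_cases h : m = j
  · subst h; rfl
  · simp [h]

lemma end_apply (D : Module.End Ffld Vsp) (x : Vsp) (j : ℤ) :
    D x j = ∑ i ∈ x.support, x i * D (Finsupp.single i 1) j := by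
  conv_lhs => rw [← Finsupp.sum_single x, Finsupp.sum, map_sum, Finsupp.finsetSum_apply]
  refine Finset.sum_congr rfl fun i _ => ?_
  rw [← mul_one (x i), ← smul_eq_mul, ← Finsupp.smul_single, map_smul, Finsupp.smul_apply]
  simp

lemma end_ext {D D' : Module.End Ffld Vsp}
    (h : ∀ m j, D (Finsupp.single m 1) j = D' (Finsupp.single m 1) j) : D = D' := by
  ext m j
  simpa using h m j

/-- Functions `ℤ → F` of the form `m ↦ f (v ^ m)` with `f` a Laurent polynomial. -/
def IsLaurent (g : ℤ → Ffld) : Prop :=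
  ∃ (N : ℕ) (p : Polynomial Ffld), ∀ m : ℤ, (vF ^ m) ^ N * g m = p.eval (vF ^ m)

lemma IsLaurent.const (a : Ffld) : IsLaurent fun _ => a :=
  ⟨0, Polynomial.C a, fun m => by simp⟩

lemma IsLaurent.add {f g : ℤ → Ffld} (hf : IsLaurent f) (hg : IsLaurent g) :
    IsLaurent fun m => f m + g m := by
  obtain ⟨N, p, hp⟩ := hf
  obtain ⟨M, q, hq⟩ := hg
  refine ⟨N + M, Polynomial.X ^ M * p + Polynomial.X ^ N * q, fun m => ?_⟩
  simp only [Polynomial.eval_add, Polynomial.eval_mul, Polynomial.eval_pow, Polynomial.eval_X,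
    ← hp, ← hq]
  ring

lemma IsLaurent.mul {f g : ℤ → Ffld} (hf : IsLaurent f) (hg : IsLaurent g) :
    IsLaurent fun m => f m * g m := by
  obtain ⟨N, p, hp⟩ := hf
  obtain ⟨M, q, hq⟩ := hg
  refine ⟨N + M, p * q, fun m => ?_⟩
  simp only [Polynomial.eval_mul, ← hp, ← hq]
  ring

lemma isLaurent_zpow : IsLaurent fun m => vF ^ m :=
  ⟨0, Polynomial.X, fun m => by simp⟩

lemma isLaurent_zpow_neg : IsLaurent fun m => vF ^ (-m) :=
  ⟨1, 1, fun m => by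
    beta_reduce
    rw [zpow_neg, pow_one, Polynomial.eval_one, mul_inv_cancel₀ (zpow_ne_zero _ vF_ne_zero)]⟩

lemma IsLaurent.finite_zeros {g : ℤ → Ffld} (hg : IsLaurent g) (h0 : ∃ m, g m ≠ 0) :
    {m | g m = 0}.Finite := by
  obtain ⟨N, p, hp⟩ := hg
  obtain ⟨m₀, hm₀⟩ := h0
  have hp0 : p ≠ 0 := by
    rintro rfl
    have := hp m₀
    rw [Polynomial.eval_zero, mul_eq_zero] at this
    exact this.elim (pow_ne_zero _ (zpow_ne_zero _ vF_ne_zero)) hm₀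
  refine ((Polynomial.finite_setOfPred_isRoot hp0).preimage vF_zpow_injective.injOn).subset ?_
  intro m hm
  have := hp m
  rw [show g m = 0 from hm, mul_zero] at this
  exact this.symm

/-- The matrix of `D` vanishes outside the `N` diagonals `0 ≤ j - m < N`. -/
def Banded (N : ℕ) (D : Module.End Ffld Vsp) : Prop :=
  ∀ m j : ℤ, j < m ∨ m + N ≤ j → D (Finsupp.single m 1) j = 0

lemma Banded.mono {N M : ℕ} (h : N ≤ M) {D : Module.End Ffld Vsp} (hD : Banded N D) :
    Banded M D :=
  fun m j hj => hD m j (by omega)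

/-- Banded operators all of whose diagonals are Laurent polynomials in `v ^ m`. -/
def LaurentBanded (D : Module.End Ffld Vsp) : Prop :=
  (∃ N, Banded N D) ∧ ∀ a : ℤ, IsLaurent fun m => D (Finsupp.single m 1) (m + a)

lemma laurentBanded_one : LaurentBanded 1 := by
  refine ⟨⟨1, fun m j hj => ?_⟩, fun a => ?_⟩
  · rw [Module.End.one_apply, Finsupp.single_apply, if_neg (by push_cast at hj; omega)]
  · convert IsLaurent.const (if a = 0 then 1 else 0) using 2 with m
    rw [Module.End.one_apply, Finsupp.single_apply]
    exact if_congr (by omega) rfl rfl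

lemma LaurentBanded.Eop_mul {D : Module.End Ffld Vsp} (hD : LaurentBanded D) :
    LaurentBanded (Eop * D) := by
  obtain ⟨⟨N, hN⟩, hL⟩ := hD
  refine ⟨⟨N + 1, fun m j hj => ?_⟩, fun a => ?_⟩
  · rw [Module.End.mul_apply, Eop_apply]
    exact hN _ _ (by push_cast at hj; omega)
  · convert hL (a - 1) using 2 with m
    rw [Module.End.mul_apply, Eop_apply, add_sub_assoc]

lemma LaurentBanded.Tq_mul {D : Module.End Ffld Vsp} (hD : LaurentBanded D) :
    LaurentBanded (Tq * D) := by
  obtain ⟨⟨N, hN⟩, hL⟩ := hD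
  refine ⟨⟨N, fun m j hj => ?_⟩, fun a => ?_⟩
  · rw [Module.End.mul_apply, Tq_apply, hN m j hj, mul_zero]
  · convert ((IsLaurent.const (vF ^ (-a))).mul isLaurent_zpow_neg).mul (hL a) using 2 with m
    rw [Module.End.mul_apply, Tq_apply, ← zpow_add₀ vF_ne_zero, neg_add_rev]

lemma LaurentBanded.TqInv_mul {D : Module.End Ffld Vsp} (hD : LaurentBanded D) :
    LaurentBanded (TqInv * D) := by
  obtain ⟨⟨N, hN⟩, hL⟩ := hD
  refine ⟨⟨N, fun m j hj => ?_⟩, fun a => ?_⟩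
  · rw [Module.End.mul_apply, TqInv_apply, hN m j hj, mul_zero]
  · convert ((IsLaurent.const (vF ^ a)).mul isLaurent_zpow).mul (hL a) using 2 with m
    rw [Module.End.mul_apply, TqInv_apply, ← zpow_add₀ vF_ne_zero, add_comm]

lemma laurentBanded_of_mem {D : Module.End Ffld Vsp} (hD : D ∈ Aalg) : LaurentBanded D := by
  rw [Aalg, ← Subalgebra.mem_toSubmodule, Algebra.adjoin_eq_span] at hD
  induction hD using Submodule.span_induction with
  | mem x hx =>
    induction hx using Submonoid.closure_induction_left with
    | one => exact laurentBanded_one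
    | mul_left x hx y _ ih =>
      rcases hx with rfl | rfl | rfl
      exacts [ih.Eop_mul, ih.Tq_mul, ih.TqInv_mul]
  | zero => exact ⟨⟨0, fun m j _ => rfl⟩, fun a => IsLaurent.const 0⟩
  | add x y _ _ hx hy =>
    obtain ⟨⟨N, hN⟩, hx⟩ := hx
    obtain ⟨⟨M, hM⟩, hy⟩ := hy
    refine ⟨⟨N + M, fun m j hj => ?_⟩, fun a => (hx a).add (hy a)⟩
    rw [LinearMap.add_apply, Finsupp.add_apply, hN.mono (Nat.le_add_right N M) m j hj,
      hM.mono (Nat.le_add_left M N) m j hj, add_zero]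
  | smul c x _ hx =>
    obtain ⟨⟨N, hN⟩, hx⟩ := hx
    refine ⟨⟨N, fun m j hj => ?_⟩, fun a => (IsLaurent.const c).mul (hx a)⟩
    rw [LinearMap.smul_apply, Finsupp.smul_apply, hN m j hj, smul_zero]

lemma sub_eq_add_neg_one_smul (C D : Module.End Ffld Vsp) : C - D = C + (-1 : Ffld) • D := by
  ext m j
  simp [sub_eq_add_neg]

lemma sub_mem_Aalg {C D : Module.End Ffld Vsp} (hC : C ∈ Aalg) (hD : D ∈ Aalg) :
    C - D ∈ Aalg := by
  rw [sub_eq_add_neg_one_smul]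
  exact add_mem hC (Subalgebra.smul_mem _ hD _)

lemma commute_sub_left {C D G : Module.End Ffld Vsp} (hC : Commute C G) (hD : Commute D G) :
    Commute (C - D) G := by
  rw [sub_eq_add_neg_one_smul]
  exact hC.add_left (hD.smul_left _)

lemma D₁_mem : D₁ ∈ Aalg := by
  have hE : Eop ∈ Aalg := Algebra.subset_adjoin (by simp)
  have hT : Tq ∈ Aalg := Algebra.subset_adjoin (by simp)
  have hT' : TqInv ∈ Aalg := Algebra.subset_adjoin (by simp)
  exact sub_mem_Aalg (add_mem (pow_mem hT 2) (pow_mem hT' 2)) (Subalgebra.smul_mem _ hE _)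

lemma aeval_D₁_apply (P : Polynomial Ffld) {x : Vsp} {k : ℤ} (hx : ∀ i < k, x i = 0) :
    (∀ i < k, Polynomial.aeval D₁ P x i = 0) ∧
      Polynomial.aeval D₁ P x k = P.eval (diagEntry k) * x k := by
  induction P using Polynomial.induction_on' with
  | add p q hp hq =>
    simp only [map_add, LinearMap.add_apply, Finsupp.add_apply, Polynomial.eval_add, hp.2, hq.2]
    exact ⟨fun i hi => by rw [hp.1 i hi, hq.1 i hi, add_zero], by ring⟩
  | monomial n a =>
    have key : (∀ i < k, (D₁ ^ n) x i = 0) ∧ (D₁ ^ n) x k = diagEntry k ^ n * x k := by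
      induction n with
      | zero => simpa using hx
      | succ n ih =>
        simp only [pow_succ', Module.End.mul_apply, D₁_apply]
        refine ⟨fun i hi => ?_, ?_⟩
        · rw [ih.1 i hi, ih.1 (i - 1) (by omega)]; ring
        · rw [ih.2, ih.1 (k - 1) (by omega)]; ring
    simp only [Polynomial.aeval_monomial, Polynomial.eval_monomial, Module.End.mul_apply,
      Module.algebraMap_end_apply, Finsupp.smul_apply, smul_eq_mul, key.2]
    exact ⟨fun i hi => by rw [key.1 i hi, mul_zero], by ring⟩

lemma apply_lowest {D : Module.End Ffld Vsp} {a : ℤ}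
    (hD : ∀ m, ∀ j < m + a, D (Finsupp.single m 1) j = 0)
    {x : Vsp} {k : ℤ} (hx : ∀ i < k, x i = 0) :
    D x (k + a) = x k * D (Finsupp.single k 1) (k + a) := by
  rw [end_apply]
  refine Finset.sum_eq_single k (fun i _ hik => ?_) fun hk => ?_
  · rcases lt_or_gt_of_ne hik with h | h
    · rw [hx i h, zero_mul]
    · rw [hD i _ (by omega), mul_zero]
  · rw [Finsupp.notMem_support_iff.1 hk, zero_mul]

lemma eval_diagEntry_not_periodic {P : Polynomial Ffld} (hP : 1 ≤ P.degree) {k : ℤ} (hk : 0 < k)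
    (s : Set ℤ) (hs : s.Finite) :
    ∃ m ∉ s, P.eval (diagEntry m) ≠ P.eval (diagEntry (m + k)) := by
  by_contra! h
  obtain ⟨M, hM⟩ := hs.bddAbove
  set M' := max M 0 + 1
  have hconst : ∀ n : ℕ, P.eval (diagEntry (M' + n * k)) = P.eval (diagEntry M') := by
    intro n
    induction n with
    | zero => simp
    | succ n ih =>
      have h0 : 0 ≤ (n : ℤ) * k := by positivity
      rw [← ih, h (M' + n * k) fun hmem => by have := hM hmem; omega]
      congr 2
      push_cast
      ring
  have hne : P - Polynomial.C (P.eval (diagEntry M')) ≠ 0 := by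
    intro h0
    rw [sub_eq_zero.1 h0] at hP
    exact absurd (hP.trans Polynomial.degree_C_le) (by decide)
  refine Set.infinite_of_injective_forall_mem (f := fun n : ℕ => diagEntry (M' + n * k)) ?_
    (fun n => ?_) (Polynomial.finite_setOfPred_isRoot hne)
  · intro n n' hnn
    have h0 : 0 ≤ (n : ℤ) * k := by positivity
    have h0' : 0 ≤ (n' : ℤ) * k := by positivity
    have h1 : (n : ℤ) * k = n' * k := by
      rcases diagEntry_eq hnn with h1 | h1 <;> omega
    exact_mod_cast mul_right_cancel₀ hk.ne' h1
  · simp [Polynomial.IsRoot, hconst n]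

/-- An element of the centralizer of `P(D₁)` in `A` is determined by its main diagonal. -/
lemma eq_zero_of_diagonal_eq_zero {C : Module.End Ffld Vsp} (hC : C ∈ Aalg)
    {P : Polynomial Ffld} (hP : 1 ≤ P.degree) (hcomm : Commute C (Polynomial.aeval D₁ P))
    (h0 : ∀ m, C (Finsupp.single m 1) m = 0) : C = 0 := by
  obtain ⟨⟨N, hN⟩, hL⟩ := laurentBanded_of_mem hC
  have key : ∀ a : ℕ, ∀ m, ∀ j < m + (a : ℤ), C (Finsupp.single m 1) j = 0 := by
    intro a
    induction a with
    | zero => exact fun m j hj => hN m j (Or.inl (by simpa using hj))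
    | succ a ih =>
      suffices h : ∀ m, C (Finsupp.single m 1) (m + a) = 0 by
        intro m j hj
        rcases lt_or_ge j (m + a) with hja | hja
        · exact ih m j hja
        · obtain rfl : j = m + a := by push_cast at hj; omega
          exact h m
      rcases Nat.eq_zero_or_pos a with rfl | ha
      · simpa using h0
      have hrel : ∀ m, C (Finsupp.single m 1) (m + a) = 0 ∨
          P.eval (diagEntry m) = P.eval (diagEntry (m + a)) := by
        intro m
        have hs : ∀ i < m, (Finsupp.single m (1 : Ffld)) i = 0 := fun i hi =>
          Finsupp.single_eq_of_ne (by omega)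
        have h1 := aeval_D₁_apply P hs
        have h2 := apply_lowest ih h1.1
        have h3 := (aeval_D₁_apply P (ih m)).2
        have h4 := DFunLike.congr_fun (LinearMap.congr_fun hcomm.eq (Finsupp.single m 1)) (m + a)
        rw [Module.End.mul_apply, Module.End.mul_apply, h2, h3, h1.2, Finsupp.single_eq_same,
          mul_one] at h4
        exact (mul_eq_mul_right_iff.1 h4).symm
      by_contra! hne
      obtain ⟨m, hm, hPm⟩ := eval_diagEntry_not_periodic hP (k := a) (by exact_mod_cast ha) _
        ((hL a).finite_zeros hne)
      exact (hrel m).elim hm hPm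
  refine end_ext fun m j => ?_
  exact key (j - m + 1).toNat m j (by omega)

lemma D₁_pow_apply (n : ℕ) :
    Banded (n + 1) (D₁ ^ n) ∧
      ∀ m : ℤ, (D₁ ^ n) (Finsupp.single m 1) (m + n) = (-offEntry) ^ n := by
  induction n with
  | zero =>
    refine ⟨fun m j hj => ?_, fun m => by simp⟩
    rw [pow_zero, Module.End.one_apply, Finsupp.single_apply, if_neg (by push_cast at hj; omega)]
  | succ n ih =>
    simp only [pow_succ' D₁, Banded, Module.End.mul_apply, D₁_apply]
    refine ⟨fun m j hj => ?_, fun m => ?_⟩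
    · rw [ih.1 m j (by push_cast at hj ⊢; omega), ih.1 m (j - 1) (by push_cast at hj ⊢; omega)]
      ring
    · rw [ih.1 m _ (by push_cast; omega), show m + ((n + 1 : ℕ) : ℤ) - 1 = m + n by push_cast; ring,
        ih.2]
      ring

lemma commutator_D₁_apply (D : Module.End Ffld Vsp) (m j : ℤ) :
    (D * D₁ - D₁ * D) (Finsupp.single m 1) j =
      (diagEntry m - diagEntry j) * D (Finsupp.single m 1) j -
        offEntry * (D (Finsupp.single (m + 1) 1) j - D (Finsupp.single m 1) (j - 1)) := by
  rw [LinearMap.sub_apply, Finsupp.sub_apply, Module.End.mul_apply, Module.End.mul_apply,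
    D₁_apply, D₁_single, map_sub, map_smul, map_smul]
  simp only [Finsupp.sub_apply, Finsupp.smul_apply, smul_eq_mul]
  ring

lemma exists_aeval_of_commute_D₁ (N : ℕ) (D : Module.End Ffld Vsp) (hN : Banded N D)
    (hcomm : Commute D D₁) : ∃ Q : Polynomial Ffld, D = Polynomial.aeval D₁ Q := by
  induction N generalizing D with
  | zero => exact ⟨0, by rw [map_zero]; exact end_ext fun m j => hN m j (by push_cast; omega)⟩
  | succ N ih =>
    have hstep : ∀ m : ℤ, D (Finsupp.single (m + 1) 1) (m + 1 + N) =
        D (Finsupp.single m 1) (m + N) := by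
      intro m
      have h := commutator_D₁_apply D m (m + 1 + N)
      rw [sub_eq_zero.2 hcomm.eq, hN m _ (by push_cast; omega),
        show m + 1 + (N : ℤ) - 1 = m + N by ring] at h
      simp only [LinearMap.zero_apply, Finsupp.zero_apply, mul_zero, zero_sub, zero_eq_neg,
        mul_eq_zero, offEntry_ne_zero, false_or] at h
      exact sub_eq_zero.1 h
    set t := D (Finsupp.single 0 1) (0 + N) with ht
    have hconst : ∀ m : ℤ, D (Finsupp.single m 1) (m + N) = t := by
      intro m
      induction m using Int.induction_on with
      | zero => rfl
      | succ i hi => rw [hstep, hi]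
      | pred i hi => rw [← hi, ← hstep (-(i : ℤ) - 1), sub_add_cancel]
    obtain ⟨hB, htop⟩ := D₁_pow_apply N
    set s := t * ((-offEntry) ^ N)⁻¹ with hs
    obtain ⟨Q, hQ⟩ := ih (D - s • D₁ ^ N) (fun m j hj => by
        rw [LinearMap.sub_apply, Finsupp.sub_apply, LinearMap.smul_apply, Finsupp.smul_apply,
          smul_eq_mul]
        by_cases hj' : j = m + N
        · rw [hj', hconst, htop, hs, mul_assoc,
            inv_mul_cancel₀ (pow_ne_zero _ (neg_ne_zero.2 offEntry_ne_zero)), mul_one, sub_self]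
        · have hj2 : j < m ∨ m + ((N + 1 : ℕ) : ℤ) ≤ j := by push_cast; omega
          rw [hN m j hj2, hB m j hj2, mul_zero, sub_zero])
      (commute_sub_left hcomm (((Commute.refl D₁).pow_left N).smul_left s))
    refine ⟨Q + Polynomial.monomial N s, ?_⟩
    rw [map_add, ← hQ, Polynomial.aeval_monomial, ← Algebra.smul_def]
    ext m j
    simp

lemma commute_D₁_of_commute_aeval {D : Module.End Ffld Vsp} (hD : D ∈ Aalg)
    {P : Polynomial Ffld} (hP : 1 ≤ P.degree) (hcomm : Commute D (Polynomial.aeval D₁ P)) :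
    Commute D D₁ := by
  obtain ⟨⟨N, hN⟩, -⟩ := laurentBanded_of_mem hD
  have hD₁ : Commute D₁ (Polynomial.aeval D₁ P) := by
    have h := congrArg (Polynomial.aeval D₁) (mul_comm Polynomial.X P)
    rwa [map_mul, map_mul, Polynomial.aeval_X] at h
  refine sub_eq_zero.1 (eq_zero_of_diagonal_eq_zero
    (sub_mem_Aalg (mul_mem hD D₁_mem) (mul_mem D₁_mem hD)) hP
    (commute_sub_left (hcomm.mul_left hD₁) (hD₁.mul_left hcomm)) fun m => ?_)
  rw [commutator_D₁_apply, hN (m + 1) m (by omega), hN m (m - 1) (by omega)]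
  ring

/-- Lemma C.2 (centralizer in rank one): if `D ∈ A` commutes with `P(D₁)` for some
polynomial `P` of degree at least one, then `D` is a polynomial in `D₁` with
coefficients in `F`. -/
theorem centralizer_sl2 (D : Module.End Ffld Vsp) (hD : D ∈ Aalg)
    (P : Polynomial Ffld) (hP : 1 ≤ P.degree)
    (hcomm : D * Polynomial.aeval D₁ P = Polynomial.aeval D₁ P * D) :
    ∃ Q : Polynomial Ffld, D = Polynomial.aeval D₁ Q := by
  obtain ⟨⟨N, hN⟩, -⟩ := laurentBanded_of_mem hD
  exact exists_aeval_of_commute_D₁ N D hN (commute_D₁_of_commute_aeval hD hP hcomm)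

end TodaSL2

end
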